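/- ITL^CD does not derive the Fischer Servi axioms: ITL^CD ⊬ (◦p → ◦q) → ◦(p → q) and ITL^CD ⊬ (◇p → □q) → □(p → q). -/

import Mathlib

/-- Formulas of the language `L` of intuitionistic linear temporal logic. -/
inductive Formula : Type
  | bot : Formula
  | var : ℕ → Formula
  | and : Formula → Formula → Formula
  | or : Formula → Formula → Formula
  | impl : Formula → Formula → Formula
  | next : Formula → Formula
  | diam : Formula → Formula
  | box : Formula → Formula
deriving DecidableEq

namespace Formula

/-- `¬φ` abbreviates `φ → ⊥`. -/
def neg (φ : Formula) : Formula := impl φ bot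

/-- `φ ↔ ψ` abbreviates `(φ → ψ) ∧ (ψ → φ)`. -/
def iff (φ ψ : Formula) : Formula := and (impl φ ψ) (impl ψ φ)

end Formula

/-- Derivability in `ITL⁰` extended with an additional set of axioms `Ax`.
The intuitionistic propositional tautologies are generated by a standard
complete Hilbert-style axiomatization of intuitionistic propositional logic
(closed under modus ponens). -/
inductive ITL (Ax : Formula → Prop) : Formula → Prop
  | extra {φ} : Ax φ → ITL Ax φ
  -- (i) intuitionistic propositional axioms
  | then1 (φ ψ : Formula) : ITL Ax (.impl φ (.impl ψ φ))
  | then2 (φ ψ χ : Formula) :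
      ITL Ax (.impl (.impl φ (.impl ψ χ)) (.impl (.impl φ ψ) (.impl φ χ)))
  | andE1 (φ ψ : Formula) : ITL Ax (.impl (.and φ ψ) φ)
  | andE2 (φ ψ : Formula) : ITL Ax (.impl (.and φ ψ) ψ)
  | andI (φ ψ : Formula) : ITL Ax (.impl φ (.impl ψ (.and φ ψ)))
  | orI1 (φ ψ : Formula) : ITL Ax (.impl φ (.or φ ψ))
  | orI2 (φ ψ : Formula) : ITL Ax (.impl ψ (.or φ ψ))
  | orE (φ ψ χ : Formula) :
      ITL Ax (.impl (.impl φ χ) (.impl (.impl ψ χ) (.impl (.or φ ψ) χ)))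
  | botE (φ : Formula) : ITL Ax (.impl .bot φ)
  -- (ii)–(x) temporal axioms
  | nextBot : ITL Ax (.neg (.next .bot))
  | nextAnd (φ ψ : Formula) :
      ITL Ax (.iff (.next (.and φ ψ)) (.and (.next φ) (.next ψ)))
  | nextOr (φ ψ : Formula) :
      ITL Ax (.iff (.next (.or φ ψ)) (.or (.next φ) (.next ψ)))
  | nextK (φ ψ : Formula) :
      ITL Ax (.impl (.next (.impl φ ψ)) (.impl (.next φ) (.next ψ)))
  | boxK (φ ψ : Formula) :
      ITL Ax (.impl (.box (.impl φ ψ)) (.impl (.box φ) (.box ψ)))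
  | diamK (φ ψ : Formula) :
      ITL Ax (.impl (.box (.impl φ ψ)) (.impl (.diam φ) (.diam ψ)))
  | diamOr (φ ψ : Formula) :
      ITL Ax (.impl (.diam (.or φ ψ)) (.or (.diam φ) (.diam ψ)))
  | boxFix (φ : Formula) : ITL Ax (.impl (.box φ) (.and φ (.next (.box φ))))
  | diamFix (φ : Formula) : ITL Ax (.impl (.or φ (.next (.diam φ))) (.diam φ))
  -- rules (xi)–(xiv)
  | ind1 {φ : Formula} : ITL Ax (.impl φ (.next φ)) → ITL Ax (.impl φ (.box φ))
  | ind2 {φ : Formula} : ITL Ax (.impl (.next φ) φ) → ITL Ax (.impl (.diam φ) φ)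
  | mp {φ ψ : Formula} : ITL Ax (.impl φ ψ) → ITL Ax φ → ITL Ax ψ
  | nec {φ : Formula} : ITL Ax φ → ITL Ax (.next φ)

/-- The Fischer Servi axiom schemes FS◦ and FS◇. -/
def FSAx : Formula → Prop := fun χ => ∃ φ ψ : Formula,
  χ = .impl (.impl (.next φ) (.next ψ)) (.next (.impl φ ψ)) ∨
  χ = .impl (.impl (.diam φ) (.box ψ)) (.box (.impl φ ψ))

/-- The constant domain axiom scheme CD. -/
def CDAx : Formula → Prop := fun χ => ∃ φ ψ : Formula,
  χ = .impl (.box (.or φ ψ)) (.or (.box φ) (.diam ψ))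

/-- The logic ITL⁰. -/
def ITL0 : Formula → Prop := ITL (fun _ => False)

/-- The logic ITL^FS = ITL⁰ + FS◦ + FS◇. -/
def ITLFS : Formula → Prop := ITL FSAx

/-- The logic ITL^CD = ITL⁰ + CD. -/
def ITLCD : Formula → Prop := ITL CDAx

/-- The logic ITL¹ = ITL^FS + ITL^CD. -/
def ITL1 : Formula → Prop := ITL (fun χ => FSAx χ ∨ CDAx χ)

/-- A valuation on a dynamical topological system `(X, T, S)`: a map from
formulas to open sets satisfying the semantic clauses. -/
structure DTValuation (X : Type) (T : TopologicalSpace X) (S : X → X) where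
  val : Formula → Set X
  isOpen_val : ∀ φ, @IsOpen X T (val φ)
  val_bot : val .bot = ∅
  val_and : ∀ φ ψ, val (.and φ ψ) = val φ ∩ val ψ
  val_or : ∀ φ ψ, val (.or φ ψ) = val φ ∪ val ψ
  val_impl : ∀ φ ψ, val (.impl φ ψ) = @interior X T ((val φ)ᶜ ∪ val ψ)
  val_next : ∀ φ, val (.next φ) = S ⁻¹' val φ
  val_diam : ∀ φ, val (.diam φ) = ⋃ n : ℕ, (S^[n]) ⁻¹' val φ
  val_box : ∀ φ, val (.box φ) =
    ⋃₀ {U : Set X | @IsOpen X T U ∧ S '' U ⊆ U ∧ U ⊆ val φ}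

/-- The up-set topology of a preorder: the open sets are the upward closed sets. -/
def upsetTopology (X : Type) [Preorder X] : TopologicalSpace X where
  IsOpen U := IsUpperSet U
  isOpen_univ := isUpperSet_univ
  isOpen_inter := fun _ _ hU hV => hU.inter hV
  isOpen_sUnion := fun _ hs => isUpperSet_sUnion hs

/-- The propositional variables `p` and `q`. -/
def pVar : Formula := .var 0
def qVar : Formula := .var 1

/-- Forcing on a dynamic poset: a preorder with a map `S` and a valuation `V` of the variables. -/
def Forces {W : Type} [Preorder W] (S : W → W) (V : ℕ → W → Prop) : Formula → W → Prop
  | .bot, _ => False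
  | .var n, w => V n w
  | .and φ ψ, w => Forces S V φ w ∧ Forces S V ψ w
  | .or φ ψ, w => Forces S V φ w ∨ Forces S V ψ w
  | .impl φ ψ, w => ∀ v, w ≤ v → Forces S V φ v → Forces S V ψ v
  | .next φ, w => Forces S V φ (S w)
  | .diam φ, w => ∃ n : ℕ, Forces S V φ (S^[n] w)
  | .box φ, w => ∀ n : ℕ, Forces S V φ (S^[n] w)

section Soundness

variable {W : Type} [Preorder W] {S : W → W} {V : ℕ → W → Prop}

theorem Forces.mono (hS : Monotone S) (hV : ∀ n, Monotone (V n)) {φ : Formula} {w v : W}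
    (hwv : w ≤ v) (h : Forces S V φ w) : Forces S V φ v := by
  induction φ generalizing w v with
  | bot => exact h
  | var n => exact hV n hwv h
  | and φ ψ ihφ ihψ => exact ⟨ihφ hwv h.1, ihψ hwv h.2⟩
  | or φ ψ ihφ ihψ => exact h.imp (ihφ hwv) (ihψ hwv)
  | impl φ ψ _ _ => exact fun u hvu => h u (hwv.trans hvu)
  | next φ ih => exact ih (hS hwv) h
  | diam φ ih => exact h.imp fun n => ih (hS.iterate n hwv)
  | box φ ih => exact fun n => ih (hS.iterate n hwv) (h n)

/-- `ITL^CD` is sound for dynamic posets. -/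
theorem ITLCD.forces (hS : Monotone S) (hV : ∀ n, Monotone (V n)) {φ : Formula}
    (h : ITLCD φ) (w : W) : Forces S V φ w := by
  unfold ITLCD at h
  induction h generalizing w with
  | extra h =>
    obtain ⟨φ, ψ, rfl⟩ := h
    intro v _ h
    by_cases hψ : ∃ n : ℕ, Forces S V ψ (S^[n] v)
    · exact Or.inr hψ
    · exact Or.inl fun n => (h n).resolve_right fun hn => hψ ⟨n, hn⟩
  | then1 φ ψ => exact fun _ _ hφ _ hle _ => hφ.mono hS hV hle
  | then2 φ ψ χ =>
    exact fun _ _ h _ hle hψ u hu hφ => h u (hle.trans hu) hφ u le_rfl (hψ u hu hφ)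
  | andE1 φ ψ => exact fun _ _ h => h.1
  | andE2 φ ψ => exact fun _ _ h => h.2
  | andI φ ψ => exact fun _ _ hφ _ hle hψ => ⟨hφ.mono hS hV hle, hψ⟩
  | orI1 φ ψ => exact fun _ _ h => Or.inl h
  | orI2 φ ψ => exact fun _ _ h => Or.inr h
  | orE φ ψ χ =>
    exact fun _ _ hφ _ hle hψ u hu h => h.elim (hφ u (hle.trans hu)) (hψ u hu)
  | botE φ => exact fun _ _ h => h.elim
  | nextBot => exact fun _ _ h => h
  | nextAnd φ ψ => exact ⟨fun _ _ h => h, fun _ _ h => h⟩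
  | nextOr φ ψ => exact ⟨fun _ _ h => h, fun _ _ h => h⟩
  | nextK φ ψ => exact fun _ _ h _ hle hφ => h _ (hS hle) hφ
  | boxK φ ψ => exact fun _ _ h _ hle hφ n => h n _ (hS.iterate n hle) (hφ n)
  | diamK φ ψ => exact fun _ _ h _ hle hφ => hφ.imp fun n => h n _ (hS.iterate n hle)
  | diamOr φ ψ => exact fun _ _ ⟨n, h⟩ => h.imp (fun h => ⟨n, h⟩) fun h => ⟨n, h⟩
  | boxFix φ => exact fun _ _ h => ⟨h 0, fun n => h (n + 1)⟩
  | diamFix φ =>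
    rintro v _ (h | ⟨n, h⟩)
    · exact ⟨0, h⟩
    · exact ⟨n + 1, h⟩
  | ind1 _ ih =>
    intro v hwv h n
    clear hwv
    induction n generalizing v with
    | zero => exact h
    | succ n ihn => exact ihn (S v) (ih v v le_rfl h)
  | ind2 _ ih =>
    rintro v hwv ⟨n, h⟩
    clear hwv
    induction n generalizing v with
    | zero => exact h
    | succ n ihn => exact ih v v le_rfl (ihn (S v) h)
  | mp _ _ ihφψ ihφ => exact ihφψ w w le_rfl (ihφ w)
  | nec _ ih => exact ih (S w)

end Soundness

namespace FSCountermodel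

/-- The dynamics on the disjoint union of an isolated point and the chain `false < true`: the
isolated point moves to the bottom of the chain, and the chain is fixed pointwise. -/
def step : Unit ⊕ Bool → Unit ⊕ Bool
  | .inl _ => .inr false
  | .inr b => .inr b

/-- The variable `p` holds at the top of the chain only, and the other variables nowhere. -/
def valuation (n : ℕ) (w : Unit ⊕ Bool) : Prop := n = 0 ∧ w = .inr true

theorem monotone_step : Monotone step := by
  rintro (_ | a) (_ | b) h
  · exact le_rfl
  · exact absurd h Sum.not_inl_le_inr
  · exact absurd h Sum.not_inr_le_inl
  · exact h

theorem monotone_valuation (n : ℕ) : Monotone (valuation n) := by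
  rintro _ (_ | b) h ⟨hn, rfl⟩
  · exact absurd h Sum.not_inr_le_inl
  · exact ⟨hn, congrArg Sum.inr (top_le_iff.mp (Sum.inr_le_inr_iff.mp h))⟩

theorem iterate_step_inl_ne (n : ℕ) (x : Unit) : step^[n] (.inl x) ≠ .inr true := by
  cases n with
  | zero => simp
  | succ n =>
    have hfix : step^[n] (.inr false) = .inr false := Function.iterate_fixed rfl n
    simp [Function.iterate_succ_apply, step, hfix]

theorem not_forces_impl_bottom : ¬ Forces step valuation (.impl pVar qVar) (.inr false) := fun h =>
  one_ne_zero (h (.inr true) (Sum.inr_le_inr_iff.mpr bot_le) ⟨rfl, rfl⟩).1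

theorem not_forces_next_fs : ¬ Forces step valuation
    (.impl (.impl (.next pVar) (.next qVar)) (.next (.impl pVar qVar))) (.inl ()) := by
  refine fun h => not_forces_impl_bottom (h _ le_rfl ?_)
  rintro (x | b) hle hp
  · exact absurd hp.2 (iterate_step_inl_ne 1 x)
  · exact absurd hle Sum.not_inl_le_inr

theorem not_forces_diam_fs : ¬ Forces step valuation
    (.impl (.impl (.diam pVar) (.box qVar)) (.box (.impl pVar qVar))) (.inl ()) := by
  refine fun h => not_forces_impl_bottom (h _ le_rfl ?_ 1)
  rintro (x | b) hle ⟨n, hp⟩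
  · exact absurd hp.2 (iterate_step_inl_ne n x)
  · exact absurd hle Sum.not_inl_le_inr

end FSCountermodel

/-- Corollary 3: ITL^CD derives neither FS◦(p,q) nor FS◇(p,q). -/
theorem itlcd_not_derives_fs :
    ¬ ITLCD (.impl (.impl (.next pVar) (.next qVar)) (.next (.impl pVar qVar))) ∧
    ¬ ITLCD (.impl (.impl (.diam pVar) (.box qVar)) (.box (.impl pVar qVar))) := by
  exact ⟨fun h => FSCountermodel.not_forces_next_fs
      (h.forces FSCountermodel.monotone_step FSCountermodel.monotone_valuation _),
    fun h => FSCountermodel.not_forces_diam_fs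
      (h.forces FSCountermodel.monotone_step FSCountermodel.monotone_valuation _)⟩
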